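/- arXiv:1611.08757 — 2 statements merged into one kernel-verified Lean document; each statement's English description precedes it below -/
import Mathlib

section
/- Let K ⊆ ℝ^n be a bounded convex set with K = −K and vol_n(K) > 0, let a ∈ ℝ^n, and let M := sup_{x ∈ K} ⟨a,x⟩. Then for every δ with 0 < δ ≤ M, vol_n({x ∈ K : |⟨a,x⟩| ≤ δ}) ≥ (δ/M) · vol_n(K). -/
open MeasureTheory

/-- The volume of a bounded convex subset of `ℝ` depends only on the differences of its points:
the centred interval having the same length has the same volume. -/
lemma volume_centred_interval_eq {F : Set ℝ} (hF : Convex ℝ F) (hb : BddBelow F)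
    (ha : BddAbove F) :
    volume {t : ℝ | ∃ u ∈ F, ∃ v ∈ F, 2 * |t| < v - u} = volume F := by
  rcases F.eq_empty_or_nonempty with rfl | hne
  · simp
  have hset : {t : ℝ | ∃ u ∈ F, ∃ v ∈ F, 2 * |t| < v - u} =
      Set.Ioo (-((sSup F - sInf F) / 2)) ((sSup F - sInf F) / 2) := by
    ext t
    rw [Set.mem_ofPred_eq, Set.mem_Ioo, ← abs_lt]
    constructor
    · rintro ⟨u, hu, v, hv, h⟩
      linarith [csInf_le hb hu, le_csSup ha hv]
    · intro h
      obtain ⟨u, hu, hu'⟩ := exists_lt_of_csInf_lt hne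
        (show sInf F < sInf F + (sSup F - sInf F - 2 * |t|) / 2 by linarith)
      obtain ⟨v, hv, hv'⟩ := exists_lt_of_lt_csSup hne
        (show sSup F - (sSup F - sInf F - 2 * |t|) / 2 < sSup F by linarith)
      exact ⟨u, hu, v, hv, by linarith⟩
  have hlow : Set.Ioo (sInf F) (sSup F) ⊆ F := by
    intro t ht
    obtain ⟨u, hu, hu'⟩ := exists_lt_of_csInf_lt hne ht.1
    obtain ⟨v, hv, hv'⟩ := exists_lt_of_lt_csSup hne ht.2
    exact hF.ordConnected.out hu hv ⟨hu'.le, hv'.le⟩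
  have hup : F ⊆ Set.Icc (sInf F) (sSup F) := fun t ht => ⟨csInf_le hb ht, le_csSup ha ht⟩
  have h1 := measure_mono (μ := volume) hlow
  have h2 := measure_mono (μ := volume) hup
  rw [Real.volume_Ioo] at h1
  rw [Real.volume_Icc] at h2
  rw [hset, Real.volume_Ioo, le_antisymm h2 h1]
  congr 1
  ring

section Steiner

variable {ι : Type*} [DecidableEq ι]

/-- The (open) Steiner symmetrization of a convex set along the `j`-th coordinate. -/
def steinerSymm (j : ι) (K : Set (ι → ℝ)) : Set (ι → ℝ) :=
  {x | ∃ u v : ℝ, Function.update x j u ∈ K ∧ Function.update x j v ∈ K ∧ 2 * |x j| < v - u}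

lemma isOpen_steinerSymm (j : ι) {K : Set (ι → ℝ)} (hK : IsOpen K) :
    IsOpen (steinerSymm j K) := by
  simp only [steinerSymm, Set.ofPred_exists]
  refine isOpen_iUnion fun u => isOpen_iUnion fun v => ?_
  have hc (w : ℝ) : Continuous fun x : ι → ℝ => Function.update x j w :=
    continuous_id.update j continuous_const
  have hlt : IsOpen {x : ι → ℝ | 2 * |x j| < v - u} := isOpen_lt (by fun_prop) continuous_const
  exact (hK.preimage (hc u)).inter ((hK.preimage (hc v)).inter hlt)

lemma convex_steinerSymm (j : ι) {K : Set (ι → ℝ)} (hK : Convex ℝ K) :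
    Convex ℝ (steinerSymm j K) := by
  rw [convex_iff_forall_pos]
  rintro x ⟨u, v, hu, hv, hx⟩ y ⟨u', v', hu', hv', hy⟩ s t hs ht hst
  have hupd (p q : ℝ) : Function.update (s • x + t • y) j (s * p + t * q) =
      s • Function.update x j p + t • Function.update y j q := by
    ext k
    by_cases hk : k = j
    · subst hk; simp
    · simp [hk]
  refine ⟨s * u + t * u', s * v + t * v', ?_, ?_, ?_⟩
  · rw [hupd]; exact hK hu hu' hs.le ht.le hst
  · rw [hupd]; exact hK hv hv' hs.le ht.le hst
  · have h := abs_add_le (s * x j) (t * y j)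
    rw [abs_mul, abs_mul, abs_of_pos hs, abs_of_pos ht] at h
    simp only [Pi.add_apply, Pi.smul_apply, smul_eq_mul]
    linarith [mul_lt_mul_of_pos_left hx hs, mul_lt_mul_of_pos_left hy ht]

lemma neg_mem_steinerSymm (j : ι) {K : Set (ι → ℝ)} (hK : ∀ x ∈ K, -x ∈ K) :
    ∀ x ∈ steinerSymm j K, -x ∈ steinerSymm j K := by
  rintro x ⟨u, v, hu, hv, hx⟩
  have hupd (p : ℝ) : Function.update (-x) j (-p) = -Function.update x j p := by
    ext k
    by_cases hk : k = j
    · subst hk; simp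
    · simp [hk]
  refine ⟨-v, -u, ?_, ?_, ?_⟩
  · rw [hupd]; exact hK _ hv
  · rw [hupd]; exact hK _ hu
  · rw [Pi.neg_apply, abs_neg]; linarith

lemma abs_le_of_mem_steinerSymm (j : ι) {K : Set (ι → ℝ)} {k : ι} {R : ℝ}
    (hK : ∀ x ∈ K, |x k| ≤ R) : ∀ x ∈ steinerSymm j K, |x k| ≤ R := by
  rintro x ⟨u, v, hu, hv, hx⟩
  have hu := hK _ hu
  have hv := hK _ hv
  by_cases hk : k = j
  · subst hk
    simp only [Function.update_self] at hu hv
    linarith [abs_le.1 hu, abs_le.1 hv]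
  · simpa [hk] using hu

/-- Negate the coordinates in `S`. -/
def flipCoords (S : Finset ι) (x : ι → ℝ) : ι → ℝ := fun k => if k ∈ S then -x k else x k

lemma flipCoords_mem_steinerSymm {j : ι} {S : Finset ι} (hj : j ∉ S) {K : Set (ι → ℝ)}
    (hK : ∀ x ∈ K, flipCoords S x ∈ K) :
    ∀ x ∈ steinerSymm j K, flipCoords (insert j S) x ∈ steinerSymm j K := by
  rintro x ⟨u, v, hu, hv, hx⟩
  have hupd (p : ℝ) : Function.update (flipCoords (insert j S) x) j p =
      flipCoords S (Function.update x j p) := by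
    ext k
    by_cases hk : k = j
    · subst hk; simp [flipCoords, hj]
    · simp [flipCoords, hk]
  refine ⟨u, v, ?_, ?_, ?_⟩
  · rw [hupd]; exact hK _ hu
  · rw [hupd]; exact hK _ hv
  · simpa [flipCoords] using hx

lemma convex_preimage_update {K : Set (ι → ℝ)} (hK : Convex ℝ K) (x : ι → ℝ) (j : ι) :
    Convex ℝ {t : ℝ | Function.update x j t ∈ K} := by
  intro p hp q hq s t hs ht hst
  have hupd : Function.update x j (s • p + t • q) =
      s • Function.update x j p + t • Function.update x j q := by
    ext k
    by_cases hk : k = j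
    · subst hk; simp
    · simp [hk, ← add_mul, hst]
  rw [Set.mem_ofPred_eq, hupd]
  exact hK hp hq hs ht hst

lemma lmarginal_singleton_indicator_one {A : Set (ι → ℝ)} (hA : MeasurableSet A) (j : ι)
    (x : ι → ℝ) :
    lmarginal (fun _ : ι => (volume : Measure ℝ)) {j} (A.indicator 1) x =
      volume {t : ℝ | Function.update x j t ∈ A} := by
  rw [lmarginal_singleton]
  exact lintegral_indicator_one (measurable_update x hA)

variable [Fintype ι]

lemma volume_steinerSymm_inter {j : ι} {K W : Set (ι → ℝ)} (hKo : IsOpen K)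
    (hKc : Convex ℝ K) {R : ℝ} (hR : ∀ x ∈ K, |x j| ≤ R) (hW : MeasurableSet W)
    (hWj : ∀ x t, Function.update x j t ∈ W ↔ x ∈ W) :
    volume (steinerSymm j K ∩ W) = volume (K ∩ W) := by
  have hm := hKo.measurableSet.inter hW
  have hm' := (isOpen_steinerSymm j hKo).measurableSet.inter hW
  rw [← lintegral_indicator_one hm, ← lintegral_indicator_one hm', volume_pi]
  refine lintegral_eq_of_lmarginal_eq {j} (measurable_one.indicator hm')
    (measurable_one.indicator hm) ?_
  funext x
  rw [lmarginal_singleton_indicator_one hm, lmarginal_singleton_indicator_one hm']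
  by_cases hx : x ∈ W
  · simp only [Set.mem_inter_iff, hWj, hx, and_true]
    have hbd : ∀ t ∈ {t : ℝ | Function.update x j t ∈ K}, |t| ≤ R := fun t ht => by
      simpa using hR _ ht
    rw [← volume_centred_interval_eq (convex_preimage_update hKc x j)
      ⟨-R, fun t ht => (abs_le.1 (hbd t ht)).1⟩ ⟨R, fun t ht => (abs_le.1 (hbd t ht)).2⟩]
    congr 1
    ext t
    simp [steinerSymm]
  · simp [hWj, hx]

/-- Iterated Steiner symmetrization along the coordinates in `S`. -/
lemma exists_flipCoords_invariant (i : ι) {M R : ℝ} (δ : ℝ) {K : Set (ι → ℝ)} (hKo : IsOpen K)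
    (hKc : Convex ℝ K) (hKs : ∀ x ∈ K, -x ∈ K) (hR : ∀ x ∈ K, ∀ k, |x k| ≤ R)
    (hM : ∀ x ∈ K, |x i| ≤ M) (S : Finset ι) (hi : i ∉ S) :
    ∃ L : Set (ι → ℝ), IsOpen L ∧ Convex ℝ L ∧ (∀ x ∈ L, -x ∈ L) ∧
      (∀ x ∈ L, ∀ k, |x k| ≤ R) ∧ (∀ x ∈ L, |x i| ≤ M) ∧ (∀ x ∈ L, flipCoords S x ∈ L) ∧
      volume L = volume K ∧ volume (L ∩ {x | |x i| ≤ δ}) = volume (K ∩ {x | |x i| ≤ δ}) := by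
  induction S using Finset.induction_on with
  | empty =>
    refine ⟨K, hKo, hKc, hKs, hR, hM, fun x hx => ?_, rfl, rfl⟩
    have hflip : flipCoords ∅ x = x := by
      ext k
      simp [flipCoords]
    rwa [hflip]
  | insert j S hj ih =>
    obtain ⟨L, ho, hc, hs, hb, hm, hf, hv, hv'⟩ := ih fun h => hi (Finset.mem_insert_of_mem h)
    have hij : i ≠ j := fun h => hi (h ▸ Finset.mem_insert_self _ _)
    refine ⟨steinerSymm j L, isOpen_steinerSymm j ho, convex_steinerSymm j hc,
      neg_mem_steinerSymm j hs,
      fun x hx k => abs_le_of_mem_steinerSymm j (fun y hy => hb y hy k) x hx,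
      abs_le_of_mem_steinerSymm j hm, flipCoords_mem_steinerSymm hj hf, ?_, ?_⟩
    · rw [← hv]
      simpa using volume_steinerSymm_inter ho hc (fun y hy => hb y hy j) MeasurableSet.univ
        (by simp)
    · rw [← hv']
      refine volume_steinerSymm_inter ho hc (fun y hy => hb y hy j)
        (measurableSet_le (by fun_prop) measurable_const) fun x t => ?_
      simp [hij]

/-- The slab bound for a coordinate functional and an open symmetric convex body. -/
lemma slab_volume_lower_bound_coord (i : ι) {M R δ : ℝ} {K : Set (ι → ℝ)} (hKo : IsOpen K)
    (hKc : Convex ℝ K) (hKs : ∀ x ∈ K, -x ∈ K) (hR : ∀ x ∈ K, ∀ k, |x k| ≤ R)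
    (hM : ∀ x ∈ K, |x i| ≤ M) (hδ : 0 < δ) (hδM : δ ≤ M) :
    ENNReal.ofReal (δ / M) * volume K ≤ volume (K ∩ {x | |x i| ≤ δ}) := by
  obtain ⟨L, ho, hc, hs, -, hm, hf, hv, hv'⟩ := exists_flipCoords_invariant i δ hKo hKc hKs hR hM
    (Finset.univ.erase i) (Finset.notMem_erase _ _)
  rw [← hv, ← hv']
  have hM0 : 0 < M := hδ.trans_le hδM
  have hc0 : 0 ≤ δ / M := by positivity
  have hc1 : δ / M ≤ 1 := (div_le_one hM0).2 hδM
  have hLm := ho.measurableSet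
  have hWm : MeasurableSet {x : ι → ℝ | |x i| ≤ δ} :=
    measurableSet_le (by fun_prop) measurable_const
  have hrefl (x : ι → ℝ) (t : ℝ) (ht : Function.update x i t ∈ L) :
      Function.update x i (-t) ∈ L := by
    convert hs _ (hf _ ht) using 1
    ext k
    by_cases hk : k = i
    · subst hk; simp [flipCoords]
    · simp [flipCoords, hk]
  rw [← lintegral_indicator_one hLm, ← lintegral_indicator_one (hLm.inter hWm),
    ← lintegral_const_mul _ (measurable_one.indicator hLm), volume_pi]
  refine lintegral_le_of_lmarginal_le {i} ((measurable_one.indicator hLm).const_mul _)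
    (measurable_one.indicator (hLm.inter hWm)) fun x => ?_
  rw [lmarginal_singleton_indicator_one (hLm.inter hWm), lmarginal_singleton]
  have hfib : ∫⁻ t : ℝ, ENNReal.ofReal (δ / M) * L.indicator 1 (Function.update x i t) =
      ENNReal.ofReal (δ / M) * volume {t : ℝ | Function.update x i t ∈ L} := by
    rw [← lmarginal_singleton_indicator_one hLm, lmarginal_singleton]
    exact lintegral_const_mul _ ((measurable_one.indicator hLm).comp (measurable_update x))
  refine hfib.trans_le ?_
  have hsmul := Measure.addHaar_smul (volume : Measure ℝ) (δ / M)
    {t : ℝ | Function.update x i t ∈ L}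
  rw [Module.finrank_self, pow_one, abs_of_nonneg hc0] at hsmul
  rw [← hsmul]
  refine measure_mono ?_
  rintro _ ⟨t, ht, rfl⟩
  have htM : |t| ≤ M := by simpa using hm _ ht
  constructor
  · have h := convex_preimage_update hc x i ht (hrefl x t ht)
      (show 0 ≤ (1 + δ / M) / 2 by positivity) (show 0 ≤ (1 - δ / M) / 2 by linarith) (by ring)
    have hcomb : ((1 + δ / M) / 2) • t + ((1 - δ / M) / 2) • -t = (δ / M) • t := by
      simp only [smul_eq_mul]
      ring
    rwa [hcomb] at h
  · simp only [Set.mem_ofPred_eq, Function.update_self, smul_eq_mul, abs_mul, abs_of_nonneg hc0]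
    calc δ / M * |t| ≤ δ / M * M := by gcongr
      _ = δ := div_mul_cancel₀ _ hM0.ne'

/-- The linear map replacing the `i`-th coordinate of `x` by `∑ k, a k * x k`. -/
def replaceCoord (a : ι → ℝ) (i : ι) : (ι → ℝ) →ₗ[ℝ] (ι → ℝ) where
  toFun x := Function.update x i (∑ k, a k * x k)
  map_add' x y := by
    ext k
    by_cases hk : k = i
    · subst hk; simp [mul_add, Finset.sum_add_distrib]
    · simp [hk]
  map_smul' c x := by
    ext k
    by_cases hk : k = i
    · subst hk; simp [Finset.mul_sum, mul_left_comm]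
    · simp [hk]

lemma replaceCoord_apply_self (a : ι → ℝ) (i : ι) (x : ι → ℝ) :
    replaceCoord a i x i = ∑ k, a k * x k := by
  simp [replaceCoord]

lemma injective_replaceCoord {a : ι → ℝ} {i : ι} (hi : a i ≠ 0) :
    Function.Injective (replaceCoord a i) := by
  rw [injective_iff_map_eq_zero]
  intro x hx
  have hne (k : ι) (hk : k ≠ i) : x k = 0 := by
    simpa [replaceCoord, hk] using congrFun hx k
  have hself := replaceCoord_apply_self a i x
  rw [hx, Finset.sum_eq_single i (fun k _ hk => by simp [hne k hk]) (by simp)] at hself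
  ext k
  by_cases hk : k = i
  · subst hk
    simpa [hi] using hself.symm
  · exact hne k hk

end Steiner

/-- **Slab-volume lower bound for symmetric convex bodies.**
If `K ⊆ ℝⁿ` is bounded, convex, symmetric (`K = -K`) and of positive volume,
`a ∈ ℝⁿ` and `M := sup_{x ∈ K} ⟨a,x⟩`, then for any `0 < δ ≤ M`,
`vol {x ∈ K : |⟨a,x⟩| ≤ δ} ≥ (δ/M) · vol K`. -/
theorem slab_volume_lower_bound (n : ℕ) (K : Set (Fin n → ℝ))
    (hconv : Convex ℝ K) (hbd : Bornology.IsBounded K) (hsymm : K = -K)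
    (hvol : 0 < volume K) (a : Fin n → ℝ) (δ : ℝ) (hδ : 0 < δ)
    (hδM : δ ≤ sSup ((fun x : Fin n → ℝ => ∑ i, a i * x i) '' K)) :
    ENNReal.ofReal (δ / sSup ((fun x : Fin n → ℝ => ∑ i, a i * x i) '' K)) * volume K ≤
      volume {x ∈ K | |∑ i, a i * x i| ≤ δ} := by
  set M := sSup ((fun x : Fin n → ℝ => ∑ i, a i * x i) '' K) with hMdef
  have hneg : ∀ x ∈ K, -x ∈ K := fun x hx => by
    rw [hsymm] at hx
    exact hx
  obtain ⟨i, hi⟩ : ∃ i, a i ≠ 0 := by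
    by_contra! h
    have hne : K.Nonempty := nonempty_of_measure_ne_zero hvol.ne'
    have : M = 0 := by simp [hMdef, h, hne.image_const]
    linarith
  have hcont : Continuous (replaceCoord a i) := (replaceCoord a i).continuous_of_finiteDimensional
  have hbdT : Bornology.IsBounded (replaceCoord a i '' K) :=
    (replaceCoord a i).toContinuousLinearMap.lipschitz.isBounded_image hbd
  obtain ⟨R, hR⟩ := hbdT.exists_norm_le
  have hRk : ∀ x ∈ replaceCoord a i '' K, ∀ k, |x k| ≤ R := fun x hx k =>
    (norm_le_pi_norm x k).trans (hR x hx)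
  have hle : ∀ x ∈ K, ∑ k, a k * x k ≤ M := fun x hx => by
    refine le_csSup ⟨R, ?_⟩ ⟨x, hx, rfl⟩
    rintro _ ⟨y, hy, rfl⟩
    simpa [replaceCoord_apply_self] using
      (le_abs_self _).trans (hRk _ (Set.mem_image_of_mem (replaceCoord a i) hy) i)
  have habs : ∀ x ∈ K, |∑ k, a k * x k| ≤ M := fun x hx => by
    refine abs_le'.2 ⟨hle x hx, ?_⟩
    simpa using hle _ (hneg x hx)
  have hopen : IsOpen (replaceCoord a i '' interior K) := by
    let e := LinearEquiv.ofInjectiveEndo (replaceCoord a i) (injective_replaceCoord hi)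
    exact e.toContinuousLinearEquiv.toHomeomorph.isOpenMap _ isOpen_interior
  have hsub : interior K ⊆ K := interior_subset
  have hneg' : ∀ x ∈ interior K, -x ∈ interior K := fun x hx => by
    have : interior K = -interior K := by
      conv_lhs => rw [hsymm]
      exact ((Homeomorph.neg (Fin n → ℝ)).preimage_interior K).symm
    rw [this] at hx
    exact hx
  have key := slab_volume_lower_bound_coord i (M := M) (R := R) hopen
    (hconv.interior.linear_image _)
    (by
      rintro _ ⟨x, hx, rfl⟩
      exact ⟨-x, hneg' x hx, map_neg _ _⟩)
    (fun x hx => hRk x (Set.image_mono hsub hx))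
    (by
      rintro _ ⟨x, hx, rfl⟩
      rw [replaceCoord_apply_self]
      exact habs x (hsub hx)) hδ hδM
  have himg : replaceCoord a i '' interior K ∩ {x | |x i| ≤ δ} =
      replaceCoord a i '' {x ∈ interior K | |∑ k, a k * x k| ≤ δ} := by
    rw [← Set.image_inter_preimage]
    congr 1
    ext x
    simp [replaceCoord_apply_self]
  rw [himg, Measure.addHaar_image_linearMap, Measure.addHaar_image_linearMap, mul_left_comm]
    at key
  have hdet : LinearMap.det (replaceCoord a i) ≠ 0 :=
    (LinearEquiv.isUnit_det'
      (LinearEquiv.ofInjectiveEndo (replaceCoord a i) (injective_replaceCoord hi))).ne_zero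
  have key' := (ENNReal.mul_le_mul_iff_right (by simpa using hdet) ENNReal.ofReal_ne_top).1 key
  have hint : volume (interior K) = volume K :=
    measure_congr (interior_ae_eq_of_null_frontier (hconv.addHaar_frontier volume))
  rw [hint] at key'
  exact key'.trans (measure_mono fun x hx => ⟨hsub hx.1, hx.2⟩)
end

section
/- Let n ≥ 2, k ≥ 1, let q ≥ 1 be an integer, Q = 2^q, and δ > 0. Suppose that for every c ∈ [0,2]^{nq} there exists z ∈ {-1,0,1}^{nq} \ {0} with |⟨c,z⟩| ≤ δ. Then for all vectors a_1, …, a_k ∈ [0,1]^n and all reals δ_1, …, δ_k ∈ (0,1/2] with Π_{i=1}^k δ_i ≥ δ, there exists x ∈ ℤ^n \ {0} with ‖x‖∞ ≤ Q such that |⟨a_i, x⟩| ≤ 2·δ_i·Q·(nq)² for all i = 1, …, k. -/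
/-- A mixed-radix system: weights for which a combination of small integers has absolute value
less than one only if all the integers vanish. -/
theorem exists_mixedRadix_weights (k : ℕ) (d : Fin k → ℝ)
    (hd : ∀ i, d i ∈ Set.Ioc (0 : ℝ) (1 / 2)) :
    ∃ W : Fin k → ℝ, (∀ i, 0 ≤ W i) ∧ ∑ i, W i / d i ≤ 2 * (∏ i, d i)⁻¹ - 2 ∧
      ∀ t : Fin k → ℤ, (∀ i, |(t i : ℝ)| ≤ (2 * d i)⁻¹) → |∑ i, W i * (t i : ℝ)| < 1 →
        ∀ i, t i = 0 := by
  induction k with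
  | zero => exact ⟨fun _ => 0, by simp, by simp, fun _ _ _ i => i.elim0⟩
  | succ k ih =>
    obtain ⟨W, hW, hsum, hsep⟩ := ih (fun i => d i.succ) (fun i => hd i.succ)
    obtain ⟨h0, h1⟩ := hd 0
    have hinv : 2 ≤ (d 0)⁻¹ := by
      rw [le_inv_comm₀ (by norm_num) h0]; linarith
    refine ⟨Fin.cons 1 (fun i => (d 0)⁻¹ * W i), ?_, ?_, ?_⟩
    · refine Fin.cases (by simp) fun i => ?_
      simpa using mul_nonneg (inv_nonneg.2 h0.le) (hW i)
    · rw [Fin.sum_univ_succ, Fin.prod_univ_succ]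
      simp only [Fin.cons_zero, Fin.cons_succ, mul_div_assoc, ← Finset.mul_sum, mul_inv, one_div]
      nlinarith [mul_le_mul_of_nonneg_left hsum (inv_nonneg.2 h0.le)]
    · intro t ht hlt
      rw [Fin.sum_univ_succ] at hlt
      simp only [Fin.cons_zero, Fin.cons_succ, mul_assoc, ← Finset.mul_sum, one_mul] at hlt
      have ht0 := ht 0
      rw [mul_inv] at ht0
      have htail : ∀ i : Fin k, t i.succ = 0 := by
        refine hsep (fun i => t i.succ) (fun i => ht i.succ) ?_
        by_contra! hge
        set S := ∑ i, W i * (t i.succ : ℝ)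
        have h2 : (d 0)⁻¹ ≤ |(d 0)⁻¹ * S| := by
          rw [abs_mul, abs_of_pos (inv_pos.2 h0)]
          exact le_mul_of_one_le_right (inv_nonneg.2 h0.le) hge
        have h3 := abs_sub_abs_le_abs_sub ((d 0)⁻¹ * S) (-(t 0 : ℝ))
        rw [abs_neg, sub_neg_eq_add, add_comm _ (t 0 : ℝ)] at h3
        linarith
      refine Fin.cases ?_ htail
      simp only [htail, Int.cast_zero, mul_zero, Finset.sum_const_zero, add_zero] at hlt
      exact Int.abs_lt_one_iff.1 (by exact_mod_cast hlt)

/-- If every vector with entries in `[0, 2]` can be balanced up to `δ`, then `k` vectors with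
entries in `[0, 1]` can be balanced simultaneously. -/
theorem exists_simultaneous_balancing {ι : Type*} [Fintype ι] [Nonempty ι] {k : ℕ} {δ : ℝ}
    (hbal : ∀ c : ι → ℝ, (∀ i, c i ∈ Set.Icc (0 : ℝ) 2) →
      ∃ z : ι → ℤ, (∀ i, |z i| ≤ 1) ∧ z ≠ 0 ∧ |∑ i, c i * (z i : ℝ)| ≤ δ)
    (a : Fin k → ι → ℝ) (ha : ∀ i j, a i j ∈ Set.Icc (0 : ℝ) 1)
    (d : Fin k → ℝ) (hd : ∀ i, d i ∈ Set.Ioc (0 : ℝ) (1 / 2)) (hδ : δ ≤ ∏ i, d i) :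
    ∃ z : ι → ℤ, (∀ i, |z i| ≤ 1) ∧ z ≠ 0 ∧
      ∀ i, |∑ j, a i j * (z j : ℝ)| ≤ 2 * d i * (Fintype.card ι : ℝ) ^ 2 := by
  obtain ⟨W, hW, hsum, hsep⟩ := exists_mixedRadix_weights k d hd
  set N : ℝ := (Fintype.card ι : ℝ)
  have hN : 1 ≤ N := Nat.one_le_cast.2 Fintype.card_pos
  set P := ∏ i, d i
  have hP : 0 < P := Finset.prod_pos fun i _ => (hd i).1
  have hε : ∀ i, 0 < 2 * N * d i := fun i => mul_pos (by linarith) (hd i).1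
  let b : Fin k → ι → ℤ := fun i j => ⌊a i j / (2 * N * d i)⌋
  have hb0 : ∀ i j, (0 : ℝ) ≤ b i j := fun i j =>
    Int.cast_nonneg (Int.floor_nonneg.2 (div_nonneg (ha i j).1 (hε i).le))
  have hb1 : ∀ i j, (b i j : ℝ) ≤ (2 * N * d i)⁻¹ := fun i j => by
    refine (Int.floor_le _).trans ?_
    rw [div_eq_mul_inv]
    exact mul_le_of_le_one_left (inv_nonneg.2 (hε i).le) (ha i j).2
  obtain ⟨z, hz1, hz0, hz⟩ := hbal (fun j => 2 * N * P * ∑ i, W i * b i j) fun j => by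
    refine ⟨mul_nonneg (by positivity)
      (Finset.sum_nonneg fun i _ => mul_nonneg (hW i) (hb0 i j)), ?_⟩
    have h : ∑ i, W i * (b i j : ℝ) ≤ (2 * N)⁻¹ * ∑ i, W i / d i := by
      rw [Finset.mul_sum]
      refine Finset.sum_le_sum fun i _ => ?_
      refine (mul_le_mul_of_nonneg_left (hb1 i j) (hW i)).trans_eq ?_
      rw [mul_inv, div_eq_mul_inv]; ring
    calc 2 * N * P * ∑ i, W i * (b i j : ℝ)
        ≤ 2 * N * P * ((2 * N)⁻¹ * (2 * P⁻¹)) := by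
          gcongr
          exact h.trans (by gcongr; linarith)
      _ = 2 := by field_simp
  have hzR : ∀ j, |(z j : ℝ)| ≤ 1 := fun j => by exact_mod_cast hz1 j
  have hswap : ∑ j, (2 * N * P * ∑ i, W i * (b i j : ℝ)) * (z j : ℝ)
      = 2 * N * P * ∑ i, W i * ((∑ j, b i j * z j : ℤ) : ℝ) := by
    push_cast
    simp only [Finset.mul_sum, Finset.sum_mul]
    rw [Finset.sum_comm]
    simp only [mul_assoc]
  have ht : ∀ i, ∑ j, b i j * z j = 0 := by
    refine hsep _ (fun i => ?_) ?_
    · push_cast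
      calc |∑ j, (b i j : ℝ) * z j| ≤ ∑ j, |(b i j : ℝ) * z j| := Finset.abs_sum_le_sum_abs _ _
        _ ≤ ∑ _j : ι, (2 * N * d i)⁻¹ := by
          refine Finset.sum_le_sum fun j _ => ?_
          rw [abs_mul, abs_of_nonneg (hb0 i j)]
          exact (mul_le_of_le_one_right (hb0 i j) (hzR j)).trans (hb1 i j)
        _ = (2 * d i)⁻¹ := by
          have := (hd i).1
          rw [Finset.sum_const, Finset.card_univ, nsmul_eq_mul]
          change N * _ = _
          field_simp
    · rw [hswap, abs_mul, abs_of_pos (by positivity)] at hz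
      by_contra! hge
      have h1 := le_mul_of_one_le_right (by positivity : 0 ≤ 2 * N * P) hge
      nlinarith
  refine ⟨z, hz1, hz0, fun i => ?_⟩
  have hcast : ∑ j, (b i j : ℝ) * z j = 0 := by exact_mod_cast ht i
  have herr : ∀ j, |a i j - 2 * N * d i * b i j| ≤ 2 * N * d i := fun j => by
    have h1 : (b i j : ℝ) * (2 * N * d i) ≤ a i j := (le_div_iff₀ (hε i)).1 (Int.floor_le _)
    have h2 : a i j < ((b i j : ℝ) + 1) * (2 * N * d i) :=
      (div_lt_iff₀ (hε i)).1 (Int.lt_floor_add_one _)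
    rw [abs_le]
    constructor <;> linarith [hε i]
  calc |∑ j, a i j * (z j : ℝ)| = |∑ j, (a i j - 2 * N * d i * b i j) * (z j : ℝ)| := by
        simp only [sub_mul, Finset.sum_sub_distrib, mul_assoc (2 * N * d i), ← Finset.mul_sum,
          hcast, mul_zero, sub_zero]
    _ ≤ ∑ j, |(a i j - 2 * N * d i * b i j) * (z j : ℝ)| :=
        Finset.abs_sum_le_sum_abs _ _
    _ ≤ ∑ _j : ι, 2 * N * d i := by
        refine Finset.sum_le_sum fun j _ => ?_
        rw [abs_mul]
        exact (mul_le_of_le_one_right (abs_nonneg _) (hzR j)).trans (herr j)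
    _ = 2 * d i * N ^ 2 := by
        rw [Finset.sum_const, Finset.card_univ, nsmul_eq_mul]
        change N * _ = _
        ring

/-- A signed binary expansion of zero is trivial. -/
theorem eq_zero_of_sum_two_pow_mul_eq_zero (q : ℕ) (y : Fin q → ℤ) (hy : ∀ l, |y l| ≤ 1)
    (h : ∑ l : Fin q, 2 ^ (l : ℕ) * y l = 0) : ∀ l, y l = 0 := by
  induction q with
  | zero => exact fun l => l.elim0
  | succ q ih =>
    rw [Fin.sum_univ_succ] at h
    simp only [Fin.val_zero, pow_zero, one_mul, Fin.val_succ, pow_succ', mul_assoc,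
      ← Finset.mul_sum] at h
    have h0 := abs_le.1 (hy 0)
    exact Fin.cases (by omega) (ih (fun l => y l.succ) (fun l => hy l.succ) (by omega))

/-- A signed binary expansion with `q` digits has absolute value at most `2 ^ q`. -/
theorem abs_sum_two_pow_mul_le (q : ℕ) (y : Fin q → ℤ) (hy : ∀ l, |y l| ≤ 1) :
    |∑ l : Fin q, 2 ^ (l : ℕ) * y l| ≤ 2 ^ q := by
  induction q with
  | zero => simp
  | succ q ih =>
    rw [Fin.sum_univ_castSucc, pow_succ, mul_two]
    refine (abs_add_le _ _).trans (add_le_add (ih _ fun l => hy l.castSucc) ?_)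
    rw [abs_mul, abs_of_nonneg (by positivity), Fin.val_last]
    exact mul_le_of_le_one_right (by positivity) (hy _)

/-- **Balancing with an enlarged coefficient range (Lemma 3.3), existence form.**
Let `n ≥ 2`, `k ≥ 1`, `q ≥ 1`, `Q = 2^q`, `δ > 0`. If for every `c ∈ [0,2]^{nq}` there is a
nonzero sign vector `z` with `|⟨c,z⟩| ≤ δ`, then for all `a₁, …, a_k ∈ [0,1]ⁿ` and
`δ₁, …, δ_k ∈ (0,1/2]` with `∏ δᵢ ≥ δ`, there is a nonzero `x ∈ ℤⁿ` with `‖x‖∞ ≤ Q` and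
`|⟨aᵢ,x⟩| ≤ 2 δᵢ Q (nq)²` for all `i`. -/
theorem balancing_large_coefficients (n k q : ℕ) (hn : 2 ≤ n) (hk : 1 ≤ k) (hq : 1 ≤ q)
    (δ : ℝ) (hδ : 0 < δ)
    (hbal : ∀ c : Fin (n * q) → ℝ, (∀ i, c i ∈ Set.Icc (0:ℝ) 2) →
      ∃ z : Fin (n * q) → ℤ, (∀ i, |z i| ≤ 1) ∧ z ≠ 0 ∧ |∑ i, c i * (z i : ℝ)| ≤ δ) :
    ∀ a : Fin k → (Fin n → ℝ), (∀ i j, a i j ∈ Set.Icc (0:ℝ) 1) →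
    ∀ d : Fin k → ℝ, (∀ i, d i ∈ Set.Ioc (0:ℝ) (1/2)) → δ ≤ ∏ i, d i →
      ∃ x : Fin n → ℤ, x ≠ 0 ∧ (∀ j, |x j| ≤ (2 : ℤ) ^ q) ∧
        ∀ i, |∑ j, a i j * (x j : ℝ)| ≤
          2 * d i * (2 : ℝ) ^ q * ((n : ℝ) * (q : ℝ)) ^ 2 := by
  intro a ha d hd hprod
  have : NeZero (n * q) := ⟨by positivity⟩
  let e : Fin n × Fin q ≃ Fin (n * q) := finProdFinEquiv
  obtain ⟨z, hz1, hz0, hz⟩ := exists_simultaneous_balancing hbal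
    (fun i m => a i (e.symm m).1 * (2 ^ ((e.symm m).2 : ℕ) / 2 ^ q))
    (fun i m => by
      have hle : (2 : ℝ) ^ ((e.symm m).2 : ℕ) / 2 ^ q ≤ 1 :=
        div_le_one_of_le₀ (pow_le_pow_right₀ one_le_two (e.symm m).2.2.le) (by positivity)
      exact ⟨mul_nonneg (ha i _).1 (by positivity),
        mul_le_one₀ (ha i _).2 (by positivity) hle⟩) d hd hprod
  refine ⟨fun j => ∑ l : Fin q, 2 ^ (l : ℕ) * z (e (j, l)), fun hx => hz0 ?_,
    fun j => abs_sum_two_pow_mul_le q _ fun l => hz1 _, fun i => ?_⟩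
  · funext m
    have h := eq_zero_of_sum_two_pow_mul_eq_zero q (fun l => z (e ((e.symm m).1, l)))
      (fun l => hz1 _) (congrFun hx (e.symm m).1) (e.symm m).2
    simpa using h
  · have hzi := hz i
    rw [← e.sum_comp, Fintype.sum_prod_type, Fintype.card_fin, Nat.cast_mul] at hzi
    simp only [Equiv.symm_apply_apply] at hzi
    have hscale : ∑ j, a i j * ((∑ l : Fin q, 2 ^ (l : ℕ) * z (e (j, l)) : ℤ) : ℝ)
        = 2 ^ q * ∑ j, ∑ l : Fin q, a i j * (2 ^ (l : ℕ) / 2 ^ q) * (z (e (j, l)) : ℝ) := by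
      push_cast
      simp only [Finset.mul_sum]
      refine Finset.sum_congr rfl fun j _ => Finset.sum_congr rfl fun l _ => ?_
      field_simp
    rw [hscale, abs_mul, abs_of_pos (by positivity)]
    calc _ ≤ (2 : ℝ) ^ q * (2 * d i * ((n : ℝ) * q) ^ 2) := by gcongr
      _ = _ := by ring
end
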